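/- Let (W, S) be a Coxeter system, (Q, φ) a maximal partial special matching on W with a = φ(e), and D = ⟨s, t⟩ a dihedral standard parabolic subgroup with a ∉ {s, t}. Then for every w ∈ Q ∩ D one has w ⋖ φ(w) and φ(w) ∉ D. -/

import Mathlib

open CoxeterSystem Polynomial

section CoxPre

variable {B : Type*} {W : Type*} [Group W] {M : CoxeterMatrix B}

/-- The alternating word of length `n` starting with the letter `i`
(and then alternating between `i` and `j`). -/
def altW (i j : B) : ℕ → List B
  | 0 => []
  | n + 1 => i :: altW j i n

variable (cs : CoxeterSystem M W)

/-- The Bruhat order on a Coxeter group: the reflexive-transitive closure of the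
relation `u → u * t` (`t` a reflection) when the length goes up. -/
def bruhatLE : W → W → Prop :=
  Relation.ReflTransGen
    (fun u v => ∃ t, cs.IsReflection t ∧ v = u * t ∧ cs.length u < cs.length v)

/-- The covering relation of the Bruhat order. -/
def bCov (u v : W) : Prop :=
  bruhatLE cs u v ∧ u ≠ v ∧ ∀ z, bruhatLE cs u z → bruhatLE cs z v → z = u ∨ z = v

/-- The set of coatoms of `v` in the Bruhat order. -/
def bCoat (v : W) : Set W := {x | bCov cs x v}

/-- A partial special matching of `W` equipped with the Bruhat order: a Bruhat order
ideal `dom` together with an involution of it such that `u ⋖ φ u` or `φ u ⋖ u` for all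
`u ∈ dom`, satisfying the coatom condition. -/
structure BSM where
  dom : Set W
  toFun : W → W
  ideal : ∀ ⦃x y : W⦄, y ∈ dom → bruhatLE cs x y → x ∈ dom
  maps : ∀ x ∈ dom, toFun x ∈ dom
  invol : ∀ x ∈ dom, toFun (toFun x) = x
  cov : ∀ x ∈ dom, bCov cs (toFun x) x ∨ bCov cs x (toFun x)
  coatom : ∀ u ∈ dom, bCov cs u (toFun u) →
    bCoat cs (toFun u) =
      {u} ∪ {w | ∃ v, bCov cs v u ∧ bCov cs v (toFun v) ∧ w = toFun v}

/-- The standard dihedral subgroup `⟨s,t⟩` of `W`, as a set. -/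
def dihedral (s t : B) : Set W :=
  (Subgroup.closure {cs.simple s, cs.simple t} : Subgroup W)

/-- `w` is full with respect to `J ⊆ S`: for all distinct `i, j ∈ J`, `m i j < ∞` and the
longest element of `⟨i,j⟩` is `≤ w` in Bruhat order. -/
def IsFullWrt (J : Set B) (w : W) : Prop :=
  ∀ i ∈ J, ∀ j ∈ J, i ≠ j →
    M i j ≠ 0 ∧ bruhatLE cs (cs.wordProd (altW i j (M i j))) w

/-- The standard axioms characterizing the `R`-polynomials of the Hecke algebra of `W`. -/
def RAxioms (R : W → W → Polynomial ℤ) : Prop :=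
  (∀ u, R u u = 1) ∧
  (∀ u v, ¬ bruhatLE cs u v → R u v = 0) ∧
  (∀ (i : B) (x y : W),
      cs.length (cs.simple i * x) = cs.length x + 1 →
      cs.length (cs.simple i * y) = cs.length y + 1 →
      R (cs.simple i * x) (cs.simple i * y) = R x y ∧
      R x (cs.simple i * y) = (X - 1) * R x y + X * R (cs.simple i * x) y) ∧
  (∀ (i : B) (x y : W),
      cs.length (x * cs.simple i) = cs.length x + 1 →
      cs.length (y * cs.simple i) = cs.length y + 1 →
      R (x * cs.simple i) (y * cs.simple i) = R x y ∧
      R x (y * cs.simple i) = (X - 1) * R x y + X * R (x * cs.simple i) y)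

variable {cs}

/-- `ψ` extends the partial special matching `φ`. -/
def BExtends (ψ φ : BSM cs) : Prop :=
  φ.dom ⊆ ψ.dom ∧ ∀ x ∈ φ.dom, ψ.toFun x = φ.toFun x

/-- `φ` is a maximal partial special matching. -/
def BMax (φ : BSM cs) : Prop := ∀ ψ : BSM cs, BExtends ψ φ → ψ.dom = φ.dom

/-- `φ` is `g`-regular on the left: its domain is stable under left multiplication by `g`
and `φ` commutes with left multiplication by `g`. -/
def LeftReg (φ : BSM cs) (g : W) : Prop :=
  (∀ x ∈ φ.dom, g * x ∈ φ.dom) ∧ ∀ x ∈ φ.dom, φ.toFun (g * x) = g * φ.toFun x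

/-- `φ` is `g`-regular on the right. -/
def RightReg (φ : BSM cs) (g : W) : Prop :=
  (∀ x ∈ φ.dom, x * g ∈ φ.dom) ∧ ∀ x ∈ φ.dom, φ.toFun (x * g) = φ.toFun x * g

end CoxPre

namespace CoxeterSystem

variable {B W : Type*} [Group W] {M : CoxeterMatrix B} (cs : CoxeterSystem M W)

section ReflectionRepresentation

/-- The pairing of two simple roots in the geometric representation. -/
noncomputable def rootPairing (M : CoxeterMatrix B) (i j : B) : ℝ :=
  -2 * Real.cos (Real.pi / M i j)

lemma rootPairing_self (M : CoxeterMatrix B) (i : B) : rootPairing M i i = 2 := by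
  simp [rootPairing]

/-- The linear functional pairing a vector with the simple root indexed by `i`. -/
noncomputable def simpleCoroot (M : CoxeterMatrix B) (i : B) : Module.Dual ℝ (B →₀ ℝ) :=
  Finsupp.linearCombination ℝ (rootPairing M i)

lemma simpleCoroot_single (M : CoxeterMatrix B) (i j : B) :
    simpleCoroot M i (Finsupp.single j 1) = rootPairing M i j := by
  simp [simpleCoroot]

lemma simpleCoroot_single_self (M : CoxeterMatrix B) (i : B) :
    simpleCoroot M i (Finsupp.single i 1) = 2 := by
  rw [simpleCoroot_single, rootPairing_self]

/-- The reflection in a simple root in the geometric representation. -/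
noncomputable def rootReflection (M : CoxeterMatrix B) (i : B) :
    (B →₀ ℝ) ≃ₗ[ℝ] (B →₀ ℝ) :=
  Module.reflection (simpleCoroot_single_self M i)

lemma rootReflection_apply (M : CoxeterMatrix B) (i : B) (z : B →₀ ℝ) :
    rootReflection M i z = z - simpleCoroot M i z • Finsupp.single i 1 :=
  Module.reflection_apply z (simpleCoroot_single_self M i)

open Polynomial.Chebyshev in
lemma isLiftable_rootReflection (M : CoxeterMatrix B) : M.IsLiftable (rootReflection M) := by
  intro i j
  obtain h0 | h1 | h2 | h3 : M i j = 0 ∨ M i j = 1 ∨ M i j = 2 ∨ 3 ≤ M i j := by omega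
  · simp [h0]
  · have hij : i = j := by
      by_contra h
      exact M.off_diagonal i j h h1
    subst hij
    ext1 z
    rw [h1, pow_one]
    exact Module.involutive_reflection (simpleCoroot_single_self M i) z
  · have hji : M j i = 2 := by rw [M.symmetric j i, h2]
    ext1 z
    have h (k l : B) (hkl : M k l = 2) :
        simpleCoroot M k (Finsupp.single l 1) = 0 := by
      rw [simpleCoroot_single, rootPairing, hkl]
      simp
    simp only [h2, pow_two, LinearEquiv.mul_apply, rootReflection_apply, map_sub, map_smul,
      h i j h2, h j i hji, simpleCoroot_single_self, LinearEquiv.coe_one, id_eq]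
    module
  · ext1 z
    set m := M i j with hm
    set θ : ℝ := 2 * (Real.pi / m) with hθ
    have hm0 : (m : ℝ) ≠ 0 := by positivity
    have hmθ : m * θ = 2 * Real.pi := by rw [hθ]; field_simp
    have hsin : Real.sin θ ≠ 0 := by
      have h3' : (3 : ℝ) ≤ m := by exact_mod_cast h3
      apply (Real.sin_pos_of_pos_of_lt_pi (by positivity) _).ne'
      nlinarith [Real.pi_pos]
    have ht : 2 * Real.cos θ = simpleCoroot M i (Finsupp.single j 1) *
        simpleCoroot M j (Finsupp.single i 1) - 2 := by
      rw [simpleCoroot_single, simpleCoroot_single, rootPairing, rootPairing, M.symmetric j i,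
        ← hm, hθ, Real.cos_two_mul]
      ring
    have hS (n : ℤ) := S_two_mul_real_cos θ n
    rw [rootReflection, rootReflection, Module.reflection_mul_reflection_pow_apply _ _ _ _ _ ht]
    obtain ⟨k, hk⟩ := Nat.even_or_odd' m
    obtain hk | hk := hk
    · have e1 : ((m : ℤ) - 2) / 2 = k - 1 := by omega
      have e2 : ((m : ℤ) - 1) / 2 = k - 1 := by omega
      have hz : (S ℝ (k - 1)).eval (2 * Real.cos θ) = 0 := by
        have := hS (k - 1)
        have hkθ : ((k - 1 : ℤ) + 1 : ℝ) * θ = Real.pi := by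
          rw [hk] at hmθ; push_cast at hmθ ⊢; linarith
        rw [hkθ, Real.sin_pi] at this
        exact (mul_eq_zero.mp this).resolve_right hsin
      simp [e1, e2, hz]
    · have e1 : ((m : ℤ) - 2) / 2 = k - 1 := by omega
      have e2 : ((m : ℤ) - 1) / 2 = k := by omega
      have e3 : ((m : ℤ) - 3) / 2 = k - 1 := by omega
      have e4 : (m : ℤ) / 2 = k := by omega
      have hz : (S ℝ k).eval (2 * Real.cos θ) + (S ℝ (k - 1)).eval (2 * Real.cos θ) = 0 := by
        have h1 := hS k
        have h2 := hS (k - 1)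
        have hkθ : ((k : ℤ) + 1 : ℝ) * θ = 2 * Real.pi - ((k - 1 : ℤ) + 1 : ℝ) * θ := by
          rw [hk] at hmθ; push_cast at hmθ ⊢; linarith
        rw [hkθ, Real.sin_two_pi_sub] at h1
        exact (mul_eq_zero.mp (by linear_combination h1 + h2)).resolve_right hsin
      simp [e1, e2, e3, e4, hz]

/-- The geometric representation of a Coxeter group. -/
noncomputable def geometricRep : W →* ((B →₀ ℝ) ≃ₗ[ℝ] (B →₀ ℝ)) :=
  cs.lift ⟨rootReflection M, isLiftable_rootReflection M⟩

lemma geometricRep_simple (i : B) : cs.geometricRep (cs.simple i) = rootReflection M i :=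
  cs.lift_apply_simple (isLiftable_rootReflection M) i

/-- A simple reflection outside a standard parabolic generating set is not in the subgroup. -/
theorem simple_notMem_closure {J : Set B} {a : B} (ha : a ∉ J) :
    cs.simple a ∉ Subgroup.closure (cs.simple '' J) := by
  have key : ∀ w ∈ Subgroup.closure (cs.simple '' J), ∀ z : B →₀ ℝ,
      cs.geometricRep w z a = z a := by
    intro w hw
    induction hw using Subgroup.closure_induction with
    | mem x hx =>
      obtain ⟨i, hi, rfl⟩ := hx
      intro z
      have hia : i ≠ a := fun h => ha (h ▸ hi)
      simp [geometricRep_simple, rootReflection_apply, hia]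
    | one => simp
    | mul x y _ _ hx hy => intro z; rw [map_mul, LinearEquiv.mul_apply, hx, hy]
    | inv x _ hx =>
      intro z
      rw [← hx, ← LinearEquiv.mul_apply, ← map_mul, mul_inv_cancel, map_one]
      rfl
  intro h
  have := key _ h (Finsupp.single a 1)
  rw [geometricRep_simple, rootReflection_apply, simpleCoroot_single_self] at this
  norm_num at this

end ReflectionRepresentation

section ReflectionCocycle

private lemma end_mul_apply {α : Type*} (f g : Function.End α) (p : α) :
    (f * g) p = f (g p) := rfl

private lemma end_one_apply {α : Type*} (p : α) : (1 : Function.End α) p = p := rfl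

open Classical in
/-- The action of a simple reflection on group elements with a sign: it conjugates the element
and flips the sign when the element is that simple reflection. -/
noncomputable def signedConj (i : B) : Function.End (W × ZMod 2) :=
  fun p => (cs.simple i * p.1 * cs.simple i, p.2 + if p.1 = cs.simple i then 1 else 0)

open Classical in
lemma signedConj_mul_pow_apply (i j : B) (n : ℕ) (x : W) (ε : ZMod 2) :
    ((cs.signedConj i * cs.signedConj j) ^ n : Function.End (W × ZMod 2)) (x, ε) =
      ((cs.simple i * cs.simple j) ^ n * x * ((cs.simple i * cs.simple j) ^ n)⁻¹,
        ε + ∑ k ∈ Finset.range (2 * n),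
          if x = (cs.simple j * cs.simple i) ^ k * cs.simple j then 1 else 0) := by
  have hinv : (cs.simple j * cs.simple i) = (cs.simple i * cs.simple j)⁻¹ := by simp
  induction n with
  | zero => simp [end_one_apply]
  | succ n ih =>
    rw [pow_succ', end_mul_apply, ih, end_mul_apply, show 2 * (n + 1) = 2 * n + 1 + 1 by ring, Finset.sum_range_succ,
      Finset.sum_range_succ]
    set c := cs.simple i * cs.simple j with hc
    have hs : cs.simple j * c ^ n = (c⁻¹) ^ n * cs.simple j := by
      have : cs.simple j * c * (cs.simple j)⁻¹ = c⁻¹ := by simp [hc, mul_assoc]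
      rw [← this, conj_pow]
      group
    have e1 : c ^ n * x * (c ^ n)⁻¹ = cs.simple j ↔
        x = (cs.simple j * cs.simple i) ^ (2 * n) * cs.simple j := by
      have e : c⁻¹ ^ (2 * n) * cs.simple j = (c ^ n)⁻¹ * (cs.simple j * c ^ n) := by
        rw [hs, two_mul, pow_add, inv_pow, mul_assoc]
      rw [hinv, e, mul_inv_eq_iff_eq_mul, eq_inv_mul_iff_mul_eq]
    have e2 : cs.simple j * (c ^ n * x * (c ^ n)⁻¹) * cs.simple j = cs.simple i ↔
        x = (cs.simple j * cs.simple i) ^ (2 * n + 1) * cs.simple j := by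
      have e : c⁻¹ ^ (2 * n + 1) * cs.simple j =
          (c ^ n)⁻¹ * (cs.simple j * cs.simple i * cs.simple j * c ^ n) := by
        rw [hinv, mul_assoc c⁻¹, hs]
        group
      rw [hinv, e]
      constructor
      · intro h
        rw [← h]
        simp [mul_assoc]
      · rintro rfl
        simp [mul_assoc]
    simp only [signedConj, e1, e2, Prod.mk.injEq]
    constructor
    · rw [pow_succ']
      simp [hc, mul_assoc]
    · ring

lemma isLiftable_signedConj : M.IsLiftable cs.signedConj := by
  classical
  intro i j
  funext ⟨x, ε⟩
  rw [signedConj_mul_pow_apply, two_mul, Finset.sum_range_add]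
  have h : (cs.simple j * cs.simple i) ^ M i j = 1 := by
    rw [M.symmetric i j, cs.simple_mul_simple_pow]
  simp only [pow_add, h, one_mul, cs.simple_mul_simple_pow, CharTwo.add_self_eq_zero]
  simp [end_one_apply]

/-- The action of a Coxeter group on its elements with signs, which recovers inversions. -/
noncomputable def signedRep : W →* Function.End (W × ZMod 2) :=
  cs.lift ⟨cs.signedConj, cs.isLiftable_signedConj⟩

/-- The parity of the number of occurrences of `x` in the inversion sequence of `w`. -/
noncomputable def inversionParity (w x : W) : ZMod 2 := (cs.signedRep w (x, 0)).2

open Classical in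
lemma signedRep_simple_apply (i : B) (p : W × ZMod 2) :
    cs.signedRep (cs.simple i) p =
      (cs.simple i * p.1 * cs.simple i, p.2 + if p.1 = cs.simple i then 1 else 0) := by
  rw [signedRep, cs.lift_apply_simple cs.isLiftable_signedConj, signedConj]

lemma signedRep_apply (w x : W) (ε : ZMod 2) :
    cs.signedRep w (x, ε) = (w * x * w⁻¹, ε + cs.inversionParity w x) := by
  induction w using cs.simple_induction_left generalizing x ε with
  | one => simp [inversionParity, end_one_apply]
  | mul_simple_left w i ih =>
    rw [inversionParity, map_mul, end_mul_apply, end_mul_apply, ih, ih, signedRep_simple_apply, signedRep_simple_apply]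
    simp [mul_assoc, add_assoc]

lemma inversionParity_mul (u v x : W) :
    cs.inversionParity (u * v) x =
      cs.inversionParity v x + cs.inversionParity u (v * x * v⁻¹) := by
  rw [inversionParity, map_mul, end_mul_apply, signedRep_apply,
    signedRep_apply, zero_add]

lemma inversionParity_one (x : W) : cs.inversionParity 1 x = 0 := by
  simp [inversionParity, end_one_apply]

open Classical in
lemma inversionParity_simple (i : B) (x : W) :
    cs.inversionParity (cs.simple i) x = if x = cs.simple i then 1 else 0 := by
  simp [inversionParity, signedRep_simple_apply]

lemma IsReflection.inversionParity_self {t : W} (ht : cs.IsReflection t) :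
    cs.inversionParity t t = 1 := by
  obtain ⟨w, i, rfl⟩ := ht
  have h := cs.inversionParity_mul w⁻¹ w (cs.simple i)
  rw [inv_mul_cancel, inversionParity_one] at h
  rw [inversionParity_mul, inversionParity_mul, inv_inv]
  have e : w⁻¹ * (w * cs.simple i * w⁻¹) * w = cs.simple i := by group
  rw [e, inversionParity_simple, if_pos rfl]
  rw [inv_simple, simple_mul_simple_self, one_mul]
  linear_combination -h

lemma mem_rightInvSeq_of_inversionParity_ne_zero (ω : List B) (x : W)
    (h : cs.inversionParity (cs.wordProd ω) x ≠ 0) : x ∈ cs.rightInvSeq ω := by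
  induction ω with
  | nil => simp [inversionParity_one] at h
  | cons i ω ih =>
    rw [rightInvSeq, List.mem_cons]
    by_cases hx : cs.inversionParity (cs.wordProd ω) x = 0
    · rw [wordProd_cons, inversionParity_mul, hx, zero_add, inversionParity_simple] at h
      left
      have h' : cs.wordProd ω * x * (cs.wordProd ω)⁻¹ = cs.simple i := by
        by_contra hne
        exact h (if_neg hne)
      rw [← h']
      group
    · exact Or.inr (ih hx)

lemma length_mul_lt_of_inversionParity_ne_zero {w x : W}
    (h : cs.inversionParity w x ≠ 0) : cs.length (w * x) < cs.length w := by
  obtain ⟨ω, hω, rfl⟩ := cs.exists_isReduced w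
  exact (cs.isRightInversion_of_mem_rightInvSeq hω
    (cs.mem_rightInvSeq_of_inversionParity_ne_zero ω x h)).2

lemma IsRightInversion.inversionParity_ne_zero {w t : W} (h : cs.IsRightInversion w t) :
    cs.inversionParity w t ≠ 0 := by
  obtain ⟨ht, hlt⟩ := h
  intro h0
  have h1 : cs.inversionParity (w * t) t ≠ 0 := by
    rw [inversionParity_mul, ht.inversionParity_self, mul_inv_cancel_right, h0]
    simp
  have := cs.length_mul_lt_of_inversionParity_ne_zero h1
  rw [mul_assoc, ht.mul_self, mul_one] at this
  omega

/-- Right inversions of elements of a standard parabolic subgroup lie in that subgroup. -/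
theorem IsRightInversion.mem_closure {J : Set B} {w t : W} (h : cs.IsRightInversion w t)
    (hw : w ∈ Subgroup.closure (cs.simple '' J)) :
    t ∈ Subgroup.closure (cs.simple '' J) := by
  have key : ∀ w ∈ Subgroup.closure (cs.simple '' J), ∀ x,
      cs.inversionParity w x ≠ 0 → x ∈ Subgroup.closure (cs.simple '' J) := by
    intro w hw
    induction hw using Subgroup.closure_induction with
    | mem y hy =>
      obtain ⟨i, hi, rfl⟩ := hy
      intro x hx
      have : x = cs.simple i := by
        by_contra hne
        exact hx (by rw [inversionParity_simple, if_neg hne])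
      exact this ▸ Subgroup.subset_closure ⟨i, hi, rfl⟩
    | one => intro x hx; exact absurd (cs.inversionParity_one x) hx
    | mul u v _ hv ihu ihv =>
      intro x hx
      by_cases h0 : cs.inversionParity v x = 0
      · rw [inversionParity_mul, h0, zero_add] at hx
        have := ihu _ hx
        rwa [Subgroup.mul_mem_cancel_right _ (inv_mem hv),
          Subgroup.mul_mem_cancel_left _ hv] at this
      · exact ihv x h0
    | inv u hu ih =>
      intro x hx
      have e := cs.inversionParity_mul u u⁻¹ x
      rw [mul_inv_cancel, inversionParity_one] at e
      have := ih (u⁻¹ * x * u⁻¹⁻¹) fun h0 => hx (by rw [h0, add_zero] at e; exact e.symm)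
      rwa [Subgroup.mul_mem_cancel_right _ (inv_mem (inv_mem hu)),
        Subgroup.mul_mem_cancel_left _ (inv_mem hu)] at this
  exact key w hw t (h.inversionParity_ne_zero)

end ReflectionCocycle

end CoxeterSystem

section Bruhat

variable {B W : Type*} [Group W] {M : CoxeterMatrix B} {cs : CoxeterSystem M W}

lemma bruhatLE.mem_closure {J : Set B} {u v : W} (h : bruhatLE cs u v)
    (hv : v ∈ Subgroup.closure (cs.simple '' J)) :
    u ∈ Subgroup.closure (cs.simple '' J) := by
  induction h with
  | refl => exact hv
  | tail _ hstep ih =>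
    obtain ⟨t, ht, rfl, hlt⟩ := hstep
    rename_i y _
    have hy : y * t * t = y := by rw [mul_assoc, ht.mul_self, mul_one]
    have hmem : t ∈ Subgroup.closure (cs.simple '' J) :=
      CoxeterSystem.IsRightInversion.mem_closure cs ⟨ht, by rwa [hy]⟩ hv
    exact ih ((Subgroup.mul_mem_cancel_right _ hmem).mp hv)

lemma bruhatLE.length_le {u v : W} (h : bruhatLE cs u v) : cs.length u ≤ cs.length v := by
  induction h with
  | refl => exact le_rfl
  | tail _ hstep ih =>
    obtain ⟨_, _, _, hlt⟩ := hstep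
    exact ih.trans hlt.le

lemma bruhatLE.eq_or_length_lt {u v : W} (h : bruhatLE cs u v) :
    u = v ∨ cs.length u < cs.length v := by
  cases h with
  | refl => exact Or.inl rfl
  | tail h hstep =>
    obtain ⟨_, _, _, hlt⟩ := hstep
    exact Or.inr ((bruhatLE.length_le h).trans_lt hlt)

lemma bCov.length_lt {u v : W} (h : bCov cs u v) : cs.length u < cs.length v :=
  h.1.eq_or_length_lt.resolve_left h.2.1

lemma exists_bCov_of_ne_one {w : W} (hw : w ≠ 1) : ∃ v, bCov cs v w := by
  obtain ⟨i, hi⟩ := cs.exists_rightDescent_of_ne_one hw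
  have hlen := (cs.isRightDescent_iff).mp hi
  refine ⟨w * cs.simple i, ?_, ?_, ?_⟩
  · exact .single ⟨cs.simple i, cs.isReflection_simple i, by simp, hi⟩
  · exact fun h => hi.ne (congrArg cs.length h)
  · intro z h1 h2
    obtain h1 | h1 := h1.eq_or_length_lt
    · exact Or.inl h1.symm
    obtain h2 | h2 := h2.eq_or_length_lt
    · exact Or.inr h2
    omega

/-- The larger of `w` and `φ w` lies above `φ 1` in the Bruhat order. -/
lemma BSM.apply_one_le (φ : BSM cs) (w : W) (hw : w ∈ φ.dom) :
    (bCov cs w (φ.toFun w) → bruhatLE cs (φ.toFun 1) (φ.toFun w)) ∧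
      (bCov cs (φ.toFun w) w → bruhatLE cs (φ.toFun 1) w) := by
  induction hn : cs.length w using Nat.strong_induction_on generalizing w with
  | _ n ih =>
    subst hn
    constructor
    · intro hcov
      by_cases h1 : w = 1
      · subst h1; exact .refl
      obtain ⟨v, hv⟩ := exists_bCov_of_ne_one (cs := cs) h1
      have hvd := φ.ideal hw hv.1
      have ihv := ih _ hv.length_lt v hvd rfl
      obtain hφv | hφv := φ.cov v hvd
      · exact ((ihv.2 hφv).trans hv.1).trans hcov.1
      · have : φ.toFun v ∈ bCoat cs (φ.toFun w) := by
          rw [φ.coatom w hw hcov]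
          exact Or.inr ⟨v, hv, hφv, rfl⟩
        exact (ihv.1 hφv).trans this.1
    · intro hcov
      have := (ih _ hcov.length_lt (φ.toFun w) (φ.maps w hw) rfl).1
      rw [φ.invol w hw] at this
      exact this hcov

end Bruhat

/-- for a maximal partial special matching `φ` with `a = φ(e)` and a
non-principal dihedral standard parabolic `D = ⟨s,t⟩` (with `a ∉ {s,t}`), every
`w ∈ dom(φ) ∩ D` satisfies `w ⋖ φ(w)` and `φ(w) ∉ D`. -/
theorem stmt5 {B : Type*} {W : Type*} [Group W] {M : CoxeterMatrix B}
    (cs : CoxeterSystem M W) (φ : BSM cs) (hmax : BMax φ)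
    (h1 : (1 : W) ∈ φ.dom) (a : B) (ha : φ.toFun 1 = cs.simple a)
    (s t : B) (hs : s ≠ a) (ht : t ≠ a)
    (w : W) (hw : w ∈ φ.dom) (hwD : w ∈ dihedral cs s t) :
    bCov cs w (φ.toFun w) ∧ φ.toFun w ∉ dihedral cs s t := by
  have hD : dihedral cs s t = Subgroup.closure (cs.simple '' {s, t}) := by
    rw [dihedral, Set.image_pair]
  rw [hD, SetLike.mem_coe] at hwD ⊢
  have hle := φ.apply_one_le w hw
  rw [ha] at hle
  have hnot : ∀ v ∈ Subgroup.closure (cs.simple '' {s, t}), ¬ bruhatLE cs (cs.simple a) v :=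
    fun v hv h => cs.simple_notMem_closure (by simp [hs.symm, ht.symm]) (h.mem_closure hv)
  have hcov : bCov cs w (φ.toFun w) :=
    (φ.cov w hw).resolve_left fun h => hnot w hwD (hle.2 h)
  exact ⟨hcov, fun h => hnot _ h (hle.1 hcov)⟩
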